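/- Local constancy of the index μ: let H : [0,1] × [0,1] → Sp(E) be a continuous family of symplectic automorphisms of a real symplectic vector space (E, ω) with H(s,0) = I for all s, and suppose dim ker(H(s,1) − I) is independent of s. Then μ(H(0,·)) = μ(H(1,·)). -/

import Mathlib

open LinearMap (BilinForm)

variable {E : Type*} [NormedAddCommGroup E] [NormedSpace ℝ E]

/-- A subspace is Lagrangian iff it equals its symplectic orthogonal. -/
def IsLagrangian (ω : BilinForm ℝ E) (L : Submodule ℝ E) : Prop :=
  LinearMap.BilinForm.orthogonal ω L = L

/-- Maximal dimension of a subspace on which the function `Q` is positive away from `0`. -/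
noncomputable def posIndex {V : Type*} [AddCommGroup V] [Module ℝ V] (Q : V → ℝ) : ℕ :=
  sSup {d : ℕ | ∃ W : Submodule ℝ V, Module.finrank ℝ W = d ∧ ∀ x ∈ W, x ≠ 0 → 0 < Q x}

/-- The quadratic form `Q(L1,L2,L3)` of a triplet of subspaces,
`Q(x1,x2,x3) = ω(x1,x2) + ω(x2,x3) + ω(x3,x1)`. -/
def tripleQ (ω : BilinForm ℝ E) (L1 L2 L3 : Submodule ℝ E) (v : L1 × L2 × L3) : ℝ :=
  ω v.1 v.2.1 + ω v.2.1 v.2.2 + ω v.2.2 v.1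

/-- The signature `s(L1,L2,L3)` of a triplet of subspaces: the signature (number of positive
squares minus number of negative squares in a diagonalization) of `Q(L1,L2,L3)`. -/
noncomputable def tripleSig (ω : BilinForm ℝ E) (L1 L2 L3 : Submodule ℝ E) : ℤ :=
  (posIndex (tripleQ ω L1 L2 L3) : ℤ) - (posIndex (fun v => - tripleQ ω L1 L2 L3 v) : ℤ)

/-- A continuous path of Lagrangian subspaces of `(E, ω)` on the interval `[a,b]`:  a family
`(L t)` of Lagrangian subspaces such that every `t0 ∈ [a,b]` has a neighbourhood `U` in `[a,b]`
on which there is a continuous family of idempotent linear maps of `E` with range `L t`. -/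
structure IsLagrangianPath (ω : BilinForm ℝ E) (a b : ℝ) (L : ℝ → Submodule ℝ E) : Prop where
  lag : ∀ t ∈ Set.Icc a b, IsLagrangian ω (L t)
  locTriv : ∀ t0 ∈ Set.Icc a b, ∃ U ∈ nhdsWithin t0 (Set.Icc a b), U ⊆ Set.Icc a b ∧
    ∃ P : ℝ → E →L[ℝ] E, ContinuousOn P U ∧
      ∀ t ∈ U, (P t).comp (P t) = P t ∧ LinearMap.range (P t : E →ₗ[ℝ] E) = L t

/-- A jointly continuous two-parameter family `(L s t)`, `s ∈ [0,1]`, `t ∈ [a,b]`, of Lagrangian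
subspaces (a homotopy of paths of Lagrangian subspaces). -/
structure IsLagrangianHomotopy (ω : BilinForm ℝ E) (a b : ℝ)
    (L : ℝ → ℝ → Submodule ℝ E) : Prop where
  lag : ∀ s ∈ Set.Icc (0:ℝ) 1, ∀ t ∈ Set.Icc a b, IsLagrangian ω (L s t)
  locTriv : ∀ p ∈ Set.Icc (0:ℝ) 1 ×ˢ Set.Icc a b,
    ∃ U ∈ nhdsWithin p (Set.Icc (0:ℝ) 1 ×ˢ Set.Icc a b),
      U ⊆ Set.Icc (0:ℝ) 1 ×ˢ Set.Icc a b ∧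
      ∃ P : ℝ × ℝ → E →L[ℝ] E, ContinuousOn P U ∧
        ∀ q ∈ U, (P q).comp (P q) = P q ∧ LinearMap.range (P q : E →ₗ[ℝ] E) = L q.1 q.2

/-- Admissible data for a pair of paths of Lagrangian subspaces on `[a,b]`:  a partition
`a = t_0 ≤ t_1 ≤ … ≤ t_k = b` together with Lagrangian subspaces `M_1, …, M_k` such that
`M_ν ∩ L_i(t) = 0` for all `t ∈ [t_{ν-1}, t_ν]`, `i = 1,2`.  (Here `M (ν+1)` plays the role
of `M_{ν+1}` for `0 ≤ ν < k`.) -/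
structure AdmissibleData (ω : BilinForm ℝ E) (a b : ℝ) (L1 L2 : ℝ → Submodule ℝ E) where
  k : ℕ
  kpos : 0 < k
  t : ℕ → ℝ
  M : ℕ → Submodule ℝ E
  ht0 : t 0 = a
  htk : t k = b
  hmono : ∀ ν < k, t ν ≤ t (ν + 1)
  hlag : ∀ ν < k, IsLagrangian ω (M (ν + 1))
  htrans1 : ∀ ν < k, ∀ s ∈ Set.Icc (t ν) (t (ν + 1)), M (ν + 1) ⊓ L1 s = ⊥
  htrans2 : ∀ ν < k, ∀ s ∈ Set.Icc (t ν) (t (ν + 1)), M (ν + 1) ⊓ L2 s = ⊥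

/-- The expression `(1/2) Σ_ν ( s(L1(t_{ν-1}), L2(t_{ν-1}), M_ν) − s(L1(t_ν), L2(t_ν), M_ν) )`
computed from admissible data; by well-definedness this is the intersection number `[L1 : L2]`. -/
noncomputable def dataSum {ω : BilinForm ℝ E} {a b : ℝ} {L1 L2 : ℝ → Submodule ℝ E}
    (D : AdmissibleData ω a b L1 L2) : ℝ :=
  (1 / 2 : ℝ) * ∑ ν ∈ Finset.range D.k,
    ((tripleSig ω (L1 (D.t ν)) (L2 (D.t ν)) (D.M (ν + 1)) : ℝ)
      - (tripleSig ω (L1 (D.t (ν + 1))) (L2 (D.t (ν + 1))) (D.M (ν + 1)) : ℝ))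

/-- A continuous path of symplectic automorphisms of `(E, ω)` on `[a,b]`. -/
structure IsSymplecticPath (ω : BilinForm ℝ E) (a b : ℝ) (A : ℝ → E →L[ℝ] E) : Prop where
  bij : ∀ t ∈ Set.Icc a b, Function.Bijective (A t)
  symp : ∀ t ∈ Set.Icc a b, ∀ x y, ω (A t x) (A t y) = ω x y
  cont : ContinuousOn A (Set.Icc a b)

/-- The symplectic form of `E × E⁻`: `((x1,x2),(y1,y2)) ↦ ω(x1,y1) − ω(x2,y2)`. -/
noncomputable def prodNegForm (ω : BilinForm ℝ E) : BilinForm ℝ (E × E) :=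
  LinearMap.mk₂ ℝ (fun x y => ω x.1 y.1 - ω x.2 y.2)
    (fun x x' y => by simp only [Prod.fst_add, Prod.snd_add, map_add, LinearMap.add_apply]; ring)
    (fun c x y => by
      simp only [Prod.smul_fst, Prod.smul_snd, map_smul, LinearMap.smul_apply, smul_eq_mul]; ring)
    (fun x y y' => by simp only [Prod.fst_add, Prod.snd_add, map_add]; ring)
    (fun c x y => by simp only [Prod.smul_fst, Prod.smul_snd, map_smul, smul_eq_mul]; ring)

/-- The graph `Γ_A = {(A x, x)}` of an endomorphism, as a subspace of `E × E`. -/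
def graphSub (A : E →L[ℝ] E) : Submodule ℝ (E × E) :=
  LinearMap.range ((A : E →ₗ[ℝ] E).prod LinearMap.id)

/-- The diagonal `Δ = {(x, x)}` in `E × E`. -/
def diagSub : Submodule ℝ (E × E) :=
  LinearMap.range ((LinearMap.id : E →ₗ[ℝ] E).prod LinearMap.id)

section Signature

open QuadraticMap QuadraticForm

variable {X Y : Type*} [AddCommGroup X] [Module ℝ X] [AddCommGroup Y] [Module ℝ Y]

/-- The signature of a real quadratic form. -/
noncomputable def formSignature (Q : QuadraticForm ℝ X) : ℤ :=
  (sigPos Q : ℤ) - (sigNeg Q : ℤ)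

theorem formSignature_neg (Q : QuadraticForm ℝ X) : formSignature (-Q) = -formSignature Q := by
  simp [formSignature]

theorem formSignature_congr {Q : QuadraticForm ℝ X} {Q' : QuadraticForm ℝ Y} (e : X ≃ₗ[ℝ] Y)
    (h : ∀ x, Q' (e x) = Q x) : formSignature Q = formSignature Q' := by
  have h' : Equivalent Q Q' := ⟨⟨e, h⟩⟩
  rw [formSignature, formSignature, h'.sigPos_eq, h'.sigNeg_eq]

theorem formSignature_eq_zero_of_neg {Q : QuadraticForm ℝ X} (e : X ≃ₗ[ℝ] X)
    (h : ∀ x, Q (e x) = -Q x) : formSignature Q = 0 := by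
  have := formSignature_congr (Q := -Q) (Q' := Q) e (by simpa using h)
  rw [formSignature_neg] at this
  omega

theorem posIndex_eq_sigPos [FiniteDimensional ℝ X] (Q : QuadraticForm ℝ X) :
    posIndex Q = sigPos Q := by
  refine IsGreatest.csSup_eq ?_
  convert! sigPos_isGreatest Q using 1
  ext d
  simp [PosDef]

theorem posIndex_sub_posIndex_neg [FiniteDimensional ℝ X] (Q : QuadraticForm ℝ X) :
    (posIndex Q : ℤ) - (posIndex fun x => -Q x : ℤ) = formSignature Q := by
  rw [formSignature, posIndex_eq_sigPos, sigNeg, ← posIndex_eq_sigPos (-Q)]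
  rfl

theorem posIndex_congr (e : X ≃ₗ[ℝ] Y) {f : X → ℝ} {g : Y → ℝ} (h : ∀ x, g (e x) = f x) :
    posIndex f = posIndex g := by
  unfold posIndex
  congr 1
  ext d
  constructor
  · rintro ⟨W, hW, hpos⟩
    refine ⟨W.map (e : X →ₗ[ℝ] Y), by rw [← hW]; exact e.finrank_map_eq W, ?_⟩
    rintro _ ⟨x, hx, rfl⟩ hne
    have := hpos x hx (by rintro rfl; simp at hne)
    simpa [h] using this
  · rintro ⟨W, hW, hpos⟩
    refine ⟨W.map (e.symm : Y →ₗ[ℝ] X), by rw [← hW]; exact e.symm.finrank_map_eq W, ?_⟩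
    rintro _ ⟨x, hx, rfl⟩ hne
    have := hpos x hx (by rintro rfl; simp at hne)
    rw [← h]
    simpa using this

theorem radical_toQuadraticMap {B : BilinForm ℝ X} (hB : ∀ x y, B x y = B y x) :
    B.toQuadraticMap.radical = LinearMap.ker B := by
  ext x
  simp only [mem_radical_iff', LinearMap.BilinMap.toQuadraticMap_apply, LinearMap.mem_ker]
  constructor
  · rintro ⟨h0, h⟩
    ext y
    have := h y
    simp only [map_add, LinearMap.add_apply, hB y x, h0] at this
    simp
    linarith
  · intro h
    have h' : ∀ y, B x y = 0 := fun y => by simp [h]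
    exact ⟨h' x, fun y => by simp [h', hB y x]⟩

theorem sigPos_prod_le [FiniteDimensional ℝ X] [FiniteDimensional ℝ Y]
    (Q : QuadraticForm ℝ X) (Q' : QuadraticForm ℝ Y) :
    sigPos Q + sigPos Q' ≤ sigPos (Q.prod Q') := by
  obtain ⟨W, hW, hpos⟩ := exists_finrank_eq_sigPos_and_posDef Q
  obtain ⟨W', hW', hpos'⟩ := exists_finrank_eq_sigPos_and_posDef Q'
  have h : ((Q.prod Q').restrict (W.prod W')).PosDef := by
    rintro ⟨⟨x, y⟩, hx, hy⟩ hne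
    simp only [restrict_apply, prod_apply]
    have h1 : ∀ z ∈ W, z ≠ 0 → 0 < Q z := fun z hz hz0 => hpos ⟨z, hz⟩ (by simpa using hz0)
    have h2 : ∀ z ∈ W', z ≠ 0 → 0 < Q' z := fun z hz hz0 => hpos' ⟨z, hz⟩ (by simpa using hz0)
    by_cases hx0 : x = 0
    · have hy0 : y ≠ 0 := by rintro rfl; simp [hx0] at hne
      simpa [hx0] using h2 y hy hy0
    · by_cases hy0 : y = 0
      · simpa [hy0] using h1 x hx hx0
      · exact add_pos (h1 x hx hx0) (h2 y hy hy0)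
  have := le_sigPos_of_posDef _ h
  rw [← hW, ← hW']
  refine le_trans (le_of_eq ?_) this
  have e : W.prod W' ≃ₗ[ℝ] W × W' :=
    { toFun := fun z => (⟨z.1.1, z.2.1⟩, ⟨z.1.2, z.2.2⟩)
      map_add' := fun _ _ => rfl
      map_smul' := fun _ _ => rfl
      invFun := fun z => ⟨(z.1, z.2), z.1.2, z.2.2⟩
      left_inv := fun _ => rfl
      right_inv := fun _ => rfl }
  rw [← Module.finrank_prod, e.finrank_eq]

theorem finrank_radical_prod [FiniteDimensional ℝ X] [FiniteDimensional ℝ Y]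
    (Q : QuadraticForm ℝ X) (Q' : QuadraticForm ℝ Y) :
    Module.finrank ℝ Q.radical + Module.finrank ℝ Q'.radical ≤
      Module.finrank ℝ (Q.prod Q').radical := by
  rw [← Module.finrank_prod]
  refine LinearMap.finrank_le_finrank_of_injective
    (f := LinearMap.codRestrict _ (Q.radical.subtype.prodMap Q'.radical.subtype) ?_) ?_
  · rintro ⟨⟨x, hx⟩, ⟨y, hy⟩⟩
    rw [mem_radical_iff'] at hx hy
    simp [mem_radical_iff', hx.1, hx.2, hy.1, hy.2]
  · rintro ⟨⟨x, hx⟩, ⟨y, hy⟩⟩ ⟨⟨x', hx'⟩, ⟨y', hy'⟩⟩ h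
    simpa using congrArg Subtype.val h

theorem formSignature_prod [FiniteDimensional ℝ X] [FiniteDimensional ℝ Y]
    (Q : QuadraticForm ℝ X) (Q' : QuadraticForm ℝ Y) :
    formSignature (Q.prod Q') = formSignature Q + formSignature Q' := by
  have h1 := sigPos_prod_le Q Q'
  have h2 := sigPos_prod_le (-Q) (-Q')
  have h3 : (-Q).prod (-Q') = -(Q.prod Q') := by
    ext x
    simp only [prod_apply, neg_apply]
    ring
  rw [h3, sigPos_neg, sigPos_neg, sigPos_neg] at h2
  have h4 := finrank_radical_prod Q Q'
  have h5 := sigPos_add_sigNeg_add_radical (Q := Q)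
  have h6 := sigPos_add_sigNeg_add_radical (Q := Q')
  have h7 := sigPos_add_sigNeg_add_radical (Q := Q.prod Q')
  rw [Module.finrank_prod] at h7
  simp only [formSignature]
  omega

theorem eventually_sigPos_ge [FiniteDimensional ℝ X] {P : Type*} {l : Filter P}
    {B : P → BilinForm ℝ X} {B₀ : BilinForm ℝ X}
    (hB : ∀ x y, Filter.Tendsto (fun p => B p x y) l (nhds (B₀ x y))) :
    ∀ᶠ p in l, sigPos B₀.toQuadraticMap ≤ sigPos (B p).toQuadraticMap := by
  obtain ⟨W, hW, hpos⟩ := exists_finrank_eq_sigPos_and_posDef B₀.toQuadraticMap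
  let w := Module.finBasis ℝ W
  let gram : BilinForm ℝ X → Fin (Module.finrank ℝ W) → Fin (Module.finrank ℝ W) → ℝ :=
    fun C i j => C (w i) (w j)
  have hgram : ∀ (C : BilinForm ℝ X) (v : W),
      C v v = ∑ i, ∑ j, w.repr v i * w.repr v j * gram C i j := by
    intro C v
    have hv : (v : X) = ∑ i, w.repr v i • (w i : X) := by
      have := congrArg W.subtype (w.sum_repr v)
      simp only [map_sum, map_smul, Submodule.subtype_apply] at this
      exact this.symm
    calc C v v = C (∑ i, w.repr v i • (w i : X)) (∑ i, w.repr v i • (w i : X)) := by rw [← hv]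
      _ = _ := by
        simp only [gram, map_sum, LinearMap.sum_apply, map_smul, LinearMap.smul_apply,
          smul_eq_mul, Finset.mul_sum, mul_assoc]
        rw [Finset.sum_comm]
        exact Finset.sum_congr rfl fun i _ => Finset.sum_congr rfl fun j _ => by ring
  let F : (Fin (Module.finrank ℝ W) → Fin (Module.finrank ℝ W) → ℝ) →
      (Fin (Module.finrank ℝ W) → ℝ) → ℝ := fun g c => ∑ i, ∑ j, c i * c j * g i j
  have hF : Continuous fun z : _ × _ => F z.1 z.2 := by
    simp only [F]
    fun_prop
  have htend : Filter.Tendsto (fun p => gram (B p)) l (nhds (gram B₀)) := by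
    rw [tendsto_pi_nhds]
    intro i
    rw [tendsto_pi_nhds]
    exact fun j => hB _ _
  have hsphere : ∀ᶠ g in nhds (gram B₀),
      ∀ c ∈ Metric.sphere (0 : Fin (Module.finrank ℝ W) → ℝ) 1, 0 < F g c := by
    refine (isCompact_sphere _ _).eventually_forall_of_forall_eventually fun c hc => ?_
    refine hF.continuousAt.eventually (lt_mem_nhds ?_)
    have hne : w.equivFun.symm c ≠ 0 := by
      intro h
      have : c = 0 := w.equivFun.symm.map_eq_zero_iff.mp h
      simp [this] at hc
    have h1 := hpos (w.equivFun.symm c) hne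
    have h2 := hgram B₀ (w.equivFun.symm c)
    have h3 : ∀ i, w.repr (w.equivFun.symm c) i = c i := fun i => by
      rw [← w.equivFun_apply, LinearEquiv.apply_symm_apply]
    simp only [h3] at h2
    simp only [restrict_apply, LinearMap.BilinMap.toQuadraticMap_apply] at h1
    rw [h2] at h1
    exact h1
  filter_upwards [htend.eventually hsphere] with p hp
  rw [← hW]
  refine le_sigPos_of_posDef _ ?_
  intro v hv
  simp only [restrict_apply, LinearMap.BilinMap.toQuadraticMap_apply]
  have hc : w.equivFun v ≠ 0 := by simpa using hv
  have hn : 0 < ‖w.equivFun v‖ := norm_pos_iff.mpr hc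
  have h1 := hp (‖w.equivFun v‖⁻¹ • w.equivFun v) (by
    rw [mem_sphere_zero_iff_norm, norm_smul, norm_inv, norm_norm, inv_mul_cancel₀ hn.ne'])
  have h2 : F (gram (B p)) (‖w.equivFun v‖⁻¹ • w.equivFun v) =
      (‖w.equivFun v‖⁻¹ * ‖w.equivFun v‖⁻¹) * B p v v := by
    rw [hgram]
    simp only [F, Finset.mul_sum, Pi.smul_apply, smul_eq_mul, w.equivFun_apply]
    refine Finset.sum_congr rfl fun i _ => Finset.sum_congr rfl fun j _ => ?_
    ring
  rw [h2] at h1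
  exact (mul_pos_iff_of_pos_left (by positivity)).mp h1

/-- Along a filter on which the rank does not drop, the signature is locally constant. -/
theorem eventually_formSignature_eq [FiniteDimensional ℝ X] {P : Type*} {l : Filter P}
    {B : P → BilinForm ℝ X} {B₀ : BilinForm ℝ X}
    (hB : ∀ x y, Filter.Tendsto (fun p => B p x y) l (nhds (B₀ x y)))
    (hsymm : ∀ x y, B₀ x y = B₀ y x) (hsymm' : ∀ᶠ p in l, ∀ x y, B p x y = B p y x)
    (hker : ∀ᶠ p in l, Module.finrank ℝ (LinearMap.ker (B p)) =
      Module.finrank ℝ (LinearMap.ker B₀)) :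
    ∀ᶠ p in l, formSignature (B p).toQuadraticMap = formSignature B₀.toQuadraticMap := by
  have hneg : ∀ C : BilinForm ℝ X, (-C).toQuadraticMap = -C.toQuadraticMap := fun C => rfl
  have h2 := eventually_sigPos_ge (B := fun p => -B p) (B₀ := -B₀) (l := l)
    fun x y => by simpa using (hB x y).neg
  filter_upwards [eventually_sigPos_ge hB, h2, hsymm', hker] with p h1 h2 hs hk
  rw [hneg, hneg, sigPos_neg, sigPos_neg] at h2
  have h5 := sigPos_add_sigNeg_add_radical (Q := (B p).toQuadraticMap)
  have h6 := sigPos_add_sigNeg_add_radical (Q := B₀.toQuadraticMap)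
  rw [radical_toQuadraticMap hs] at h5
  rw [radical_toQuadraticMap hsymm] at h6
  simp only [formSignature]
  omega

end Signature

section IndexForm

open QuadraticMap QuadraticForm

variable {X V : Type*} [AddCommGroup X] [Module ℝ X] [AddCommGroup V] [Module ℝ V]

/-- The form `(x, y) ↦ Ω (π (G x)) (G y)`, where `π` is the projection onto `Δ` along `M`. -/
noncomputable def indexForm (Ω : BilinForm ℝ V) {Δ M : Submodule ℝ V} (hc : IsCompl Δ M)
    (G : X →ₗ[ℝ] V) : BilinForm ℝ X :=
  Ω.comp (Δ.projection M hc ∘ₗ G) G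

theorem indexForm_apply (Ω : BilinForm ℝ V) {Δ M : Submodule ℝ V} (hc : IsCompl Δ M)
    (G : X →ₗ[ℝ] V) (x y : X) : indexForm Ω hc G x y = Ω (Δ.projection M hc (G x)) (G y) :=
  rfl

/-- A subspace on which the bilinear form vanishes. -/
def IsIsotropic (Ω : BilinForm ℝ V) (L : Submodule ℝ V) : Prop :=
  ∀ x ∈ L, ∀ y ∈ L, Ω x y = 0

variable {Ω : BilinForm ℝ V} {Δ M M' : Submodule ℝ V}

theorem apply_eq_projection_sub (halt : LinearMap.IsAlt Ω) (hc : IsCompl Δ M)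
    (hΔ : IsIsotropic Ω Δ) (hM : IsIsotropic Ω M) (v w : V) :
    Ω v w = Ω (Δ.projection M hc v) w - Ω (Δ.projection M hc w) v := by
  have h1 := hM _ (Δ.sub_projection_mem hc v) _ (Δ.sub_projection_mem hc w)
  have h2 := hΔ _ (Δ.projection_apply_mem hc v) _ (Δ.projection_apply_mem hc w)
  have h3 := halt.neg (Δ.projection M hc w) v
  simp only [map_sub, LinearMap.sub_apply] at h1
  linarith

theorem indexForm_symm (halt : LinearMap.IsAlt Ω) (hc : IsCompl Δ M) (hΔ : IsIsotropic Ω Δ)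
    (hM : IsIsotropic Ω M) {G : X →ₗ[ℝ] V} (hG : IsIsotropic Ω (LinearMap.range G)) (x y : X) :
    indexForm Ω hc G x y = indexForm Ω hc G y x := by
  have h0 : Ω (G x) (G y) = 0 := hG _ ⟨x, rfl⟩ _ ⟨y, rfl⟩
  rw [apply_eq_projection_sub halt hc hΔ hM] at h0
  simp only [indexForm_apply]
  linarith

theorem ker_indexForm (hc : IsCompl Δ M) {G : X →ₗ[ℝ] V}
    (hG : IsIsotropic Ω (LinearMap.range G))
    (hmax : ∀ v, (∀ y, Ω v (G y) = 0) → v ∈ LinearMap.range G)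
    (hMG : M ⊓ LinearMap.range G = ⊥) :
    LinearMap.ker (indexForm Ω hc G) = Δ.comap G := by
  ext x
  rw [LinearMap.mem_ker, Submodule.mem_comap]
  constructor
  · intro h
    have h1 := hmax (Δ.projection M hc (G x)) fun y => by
      rw [← indexForm_apply, h]; rfl
    have h2 : G x - Δ.projection M hc (G x) ∈ M ⊓ LinearMap.range G :=
      ⟨Δ.sub_projection_mem hc _, Submodule.sub_mem _ ⟨x, rfl⟩ h1⟩
    rw [hMG, Submodule.mem_bot, sub_eq_zero] at h2
    rw [h2]
    exact Δ.projection_apply_mem hc _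
  · intro h
    ext y
    rw [indexForm_apply, Δ.projection_apply_of_mem_left hc h]
    exact hG _ ⟨x, rfl⟩ _ ⟨y, rfl⟩

/-- The difference of the projections onto `Δ` along `M'` and along `M`. -/
noncomputable def projDiff (hc : IsCompl Δ M) (hc' : IsCompl Δ M') : V →ₗ[ℝ] V :=
  Δ.projection M' hc' - Δ.projection M hc

theorem projDiff_mem (hc : IsCompl Δ M) (hc' : IsCompl Δ M') (v : V) :
    projDiff hc hc' v ∈ Δ :=
  Δ.sub_mem (Δ.projection_apply_mem hc' v) (Δ.projection_apply_mem hc v)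

theorem projDiff_symm (halt : LinearMap.IsAlt Ω) (hc : IsCompl Δ M) (hc' : IsCompl Δ M')
    (hΔ : IsIsotropic Ω Δ) (hM : IsIsotropic Ω M) (hM' : IsIsotropic Ω M') (v w : V) :
    Ω (projDiff hc hc' v) w = Ω (projDiff hc hc' w) v := by
  have h := apply_eq_projection_sub halt hc hΔ hM v w
  have h' := apply_eq_projection_sub halt hc' hΔ hM' v w
  simp only [projDiff, LinearMap.sub_apply, map_sub]
  linarith

/-- The correction form comparing the index forms for two complements of `Δ`. -/
noncomputable def correctionForm (Ω : BilinForm ℝ V) (hc : IsCompl Δ M) (hc' : IsCompl Δ M')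
    (G : X →ₗ[ℝ] V) (Y : V →ₗ[ℝ] X) : BilinForm ℝ V :=
  Ω.comp (projDiff hc hc') (G ∘ₗ Y + LinearMap.id)

theorem correctionForm_apply (hc : IsCompl Δ M) (hc' : IsCompl Δ M')
    (G : X →ₗ[ℝ] V) (Y : V →ₗ[ℝ] X) (v w : V) :
    correctionForm Ω hc hc' G Y v w = Ω (projDiff hc hc' v) (G (Y w) + w) :=
  rfl

section

variable [FiniteDimensional ℝ V] (halt : LinearMap.IsAlt Ω) (hc : IsCompl Δ M)
  (hc' : IsCompl Δ M') (hΔ : IsIsotropic Ω Δ) (hM : IsIsotropic Ω M) (hM' : IsIsotropic Ω M')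
  {G : X →ₗ[ℝ] V} (hG : IsIsotropic Ω (LinearMap.range G)) {Y : V →ₗ[ℝ] X}
  (hY : ∀ v, Δ.projection M hc (G (Y v)) = projDiff hc hc' v)

omit [FiniteDimensional ℝ V] in
include halt hΔ hM hM' hG hY in
theorem correctionForm_symm (v w : V) :
    correctionForm Ω hc hc' G Y v w = correctionForm Ω hc hc' G Y w v := by
  simp only [correctionForm_apply, map_add]
  rw [projDiff_symm halt hc hc' hΔ hM hM' v w, ← hY, ← hY, ← indexForm_apply, ← indexForm_apply,
    indexForm_symm halt hc hΔ hM hG]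

include halt hΔ hM hM' hG hY in
theorem formSignature_indexForm_sub [FiniteDimensional ℝ X] :
    formSignature (indexForm Ω hc' G).toQuadraticMap -
        formSignature (indexForm Ω hc G).toQuadraticMap =
      formSignature (Ω.comp (projDiff hc hc') LinearMap.id).toQuadraticMap -
        formSignature (correctionForm Ω hc hc' G Y).toQuadraticMap := by
  set r : BilinForm ℝ V := Ω.comp (projDiff hc hc') LinearMap.id with hr
  have key : formSignature ((indexForm Ω hc' G).toQuadraticMap.prod (-r.toQuadraticMap)) =
      formSignature ((indexForm Ω hc G).toQuadraticMap.prod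
        (-(correctionForm Ω hc hc' G Y).toQuadraticMap)) := by
    let e₁ : (X × V) ≃ₗ[ℝ] X × V :=
      { toFun := fun z => (z.1, z.2 + G z.1)
        map_add' := fun z z' => by ext <;> simp; abel
        map_smul' := fun c z => by ext <;> simp
        invFun := fun z => (z.1, z.2 - G z.1)
        left_inv := fun z => by simp
        right_inv := fun z => by simp }
    let e₂ : (X × V) ≃ₗ[ℝ] X × V :=
      { toFun := fun z => (z.1 + Y z.2, z.2)
        map_add' := fun z z' => by ext <;> simp; abel
        map_smul' := fun c z => by ext <;> simp
        invFun := fun z => (z.1 - Y z.2, z.2)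
        left_inv := fun z => by simp
        right_inv := fun z => by simp }
    refine (formSignature_congr (e₂.trans e₁) ?_).symm
    rintro ⟨x, v⟩
    simp only [LinearEquiv.trans_apply, e₁, e₂, LinearEquiv.coe_mk, LinearMap.coe_mk,
      AddHom.coe_mk, prod_apply, LinearMap.BilinMap.toQuadraticMap_apply, neg_apply]
    set y := x + Y v with hy
    have hx : x = y - Y v := by simp [hy]
    have h1 : indexForm Ω hc' G y y = indexForm Ω hc G y y + Ω (projDiff hc hc' (G y)) (G y) := by
      simp [indexForm_apply, projDiff]
    have h2 : Ω (projDiff hc hc' v) (G y) = indexForm Ω hc G (Y v) y := by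
      rw [← hY, indexForm_apply]
    have h3 := projDiff_symm halt hc hc' hΔ hM hM' v (G y)
    have h4 := indexForm_symm halt hc hΔ hM hG (Y v) y
    have h5 : Ω (projDiff hc hc' v) (G (Y v)) = indexForm Ω hc G (Y v) (Y v) := by
      rw [← hY, indexForm_apply]
    have h6 : r (v + G y) (v + G y) = Ω (projDiff hc hc' (v + G y)) (v + G y) := rfl
    rw [h1, h6, correctionForm_apply, hx]
    simp only [map_sub, map_add, LinearMap.sub_apply, LinearMap.add_apply]
    linarith
  rw [formSignature_prod, formSignature_prod, formSignature_neg, formSignature_neg] at key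
  linarith

include hY in
theorem ker_correctionForm (hnd : Ω.Nondegenerate) (hM'G : M' ⊓ LinearMap.range G = ⊥) :
    LinearMap.ker (correctionForm Ω hc hc' G Y) = LinearMap.ker (projDiff hc hc') := by
  have hinj : Function.Injective (G ∘ₗ Y + LinearMap.id : V →ₗ[ℝ] V) := by
    rw [← LinearMap.ker_eq_bot, Submodule.eq_bot_iff]
    intro v hv
    have hv' : v = -G (Y v) := by
      rw [LinearMap.mem_ker] at hv
      exact eq_neg_of_add_eq_zero_right (by simpa using hv)
    have h1 : Δ.projection M' hc' (G (Y v)) = 0 := by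
      have := hY v
      rw [show projDiff hc hc' v = -projDiff hc hc' (G (Y v)) by
        conv_lhs => rw [hv']
        rw [map_neg]] at this
      rw [projDiff, LinearMap.sub_apply, neg_sub, eq_comm, sub_eq_self] at this
      exact this
    rw [Submodule.projection_apply_eq_zero_iff] at h1
    have h2 : G (Y v) ∈ M' ⊓ LinearMap.range G := ⟨h1, _, rfl⟩
    rw [hM'G, Submodule.mem_bot] at h2
    rw [hv', h2, neg_zero]
  have hsurj := LinearMap.surjective_of_injective hinj
  ext v
  rw [LinearMap.mem_ker, LinearMap.mem_ker]
  constructor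
  · intro h
    refine hnd.1 _ fun w => ?_
    obtain ⟨u, rfl⟩ := hsurj w
    exact congrArg (fun f => f u) h
  · intro h
    ext w
    simp [correctionForm_apply, h]

end

end IndexForm

section Transversality

theorem exists_notMem_of_ne_top {V : Type*} [AddCommGroup V] [Module ℝ V]
    {A B : Submodule ℝ V} (hA : A ≠ ⊤) (hB : B ≠ ⊤) : ∃ x, x ∉ A ∧ x ∉ B := by
  classical
  have h := Subspace.biUnion_ne_univ_of_top_notMem (s := {A, B}) (by
    simp [hA.symm, hB.symm])
  rw [Set.ne_univ_iff_exists_notMem] at h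
  obtain ⟨x, hx⟩ := h
  exact ⟨x, by simpa using hx⟩

variable {V : Type*} [NormedAddCommGroup V] [NormedSpace ℝ V] {Ω : BilinForm ℝ V}
  {L L₁ L₂ M : Submodule ℝ V}

theorem IsLagrangian.isIsotropic (h : IsLagrangian Ω L) : IsIsotropic Ω L := by
  intro x hx y hy
  rw [IsLagrangian] at h
  rw [← h] at hy
  exact hy x hx

theorem IsLagrangian.mem_of_forall (halt : LinearMap.IsAlt Ω) (h : IsLagrangian Ω L) {v : V}
    (hv : ∀ w ∈ L, Ω v w = 0) : v ∈ L := by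
  rw [IsLagrangian] at h
  rw [← h]
  intro w hw
  rw [← halt.neg, hv w hw, neg_zero]

variable [FiniteDimensional ℝ V]

theorem IsLagrangian.two_mul_finrank (hnd : Ω.Nondegenerate) (h : IsLagrangian Ω L) :
    2 * Module.finrank ℝ L = Module.finrank ℝ V := by
  have h1 := LinearMap.BilinForm.finrank_orthogonal hnd L
  rw [h] at h1
  have := L.finrank_le
  omega

theorem IsLagrangian.isCompl (hnd : Ω.Nondegenerate) (h₁ : IsLagrangian Ω L₁)
    (h₂ : IsLagrangian Ω L₂) (h : L₂ ⊓ L₁ = ⊥) : IsCompl L₁ L₂ := by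
  have h1 := h₁.two_mul_finrank hnd
  have h2 := h₂.two_mul_finrank hnd
  have hd : Disjoint L₁ L₂ := by rw [disjoint_iff, inf_comm, h]
  refine ⟨hd, codisjoint_iff.mpr ?_⟩
  apply Submodule.eq_top_of_finrank_eq
  have := Submodule.finrank_sup_add_finrank_inf_eq L₁ L₂
  rw [inf_comm, h, finrank_bot] at this
  omega

theorem not_orthogonal_le_sup (halt : LinearMap.IsAlt Ω) (hnd : Ω.Nondegenerate)
    (hL : IsLagrangian Ω L) (hM : M < Ω.orthogonal M) (hML : M ⊓ L = ⊥) :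
    ¬ Ω.orthogonal M ≤ L ⊔ M := by
  intro hle
  have h1 : L ⊓ Ω.orthogonal M ≤ M := by
    rintro v ⟨hvL, hvM⟩
    refine (LinearMap.BilinForm.orthogonal_orthogonal hnd halt.isRefl M).le fun w hw => ?_
    obtain ⟨a, ha, b, hb, rfl⟩ := Submodule.mem_sup.mp (hle hw)
    have ha' := hL.isIsotropic a ha v hvL
    have hb' : Ω b v = 0 := hvM b hb
    simp [ha', hb']
  have h2 : Disjoint L (Ω.orthogonal M) := by
    rw [disjoint_iff, eq_bot_iff, ← hML]
    exact le_inf h1 inf_le_left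
  have h3 := Submodule.finrank_add_finrank_le_of_disjoint h2
  have h4 := LinearMap.BilinForm.finrank_orthogonal hnd M
  have h5 := Submodule.finrank_lt_finrank_of_lt hM
  have h6 := hL.two_mul_finrank hnd
  have h7 := M.finrank_le
  omega

omit [FiniteDimensional ℝ V] in
theorem sup_span_inf_eq_bot {x : V} (hML : M ⊓ L = ⊥) (hx : x ∉ L ⊔ M) :
    (M ⊔ Submodule.span ℝ {x}) ⊓ L = ⊥ := by
  rw [Submodule.eq_bot_iff]
  rintro v ⟨hv, hvL⟩
  obtain ⟨m, hm, y, hy, rfl⟩ := Submodule.mem_sup.mp hv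
  obtain ⟨c, rfl⟩ := Submodule.mem_span_singleton.mp hy
  have hc : c = 0 := by
    by_contra hc
    apply hx
    have h1 : c • x ∈ L ⊔ M := by
      rw [show c • x = (m + c • x) - m by abel]
      exact Submodule.sub_mem _ (Submodule.mem_sup_left hvL) (Submodule.mem_sup_right hm)
    exact (Submodule.smul_mem_iff _ hc).mp h1
  subst hc
  have : m + (0 : ℝ) • x ∈ M ⊓ L := ⟨by simpa using hm, hvL⟩
  rwa [hML, Submodule.mem_bot] at this

/-- Two Lagrangian subspaces have a common Lagrangian complement. -/
theorem exists_isLagrangian_inf_eq_bot (halt : LinearMap.IsAlt Ω) (hnd : Ω.Nondegenerate)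
    (h₁ : IsLagrangian Ω L₁) (h₂ : IsLagrangian Ω L₂) :
    ∃ M, IsLagrangian Ω M ∧ M ⊓ L₁ = ⊥ ∧ M ⊓ L₂ = ⊥ := by
  obtain ⟨M, ⟨hM, hM₁, hM₂⟩, hmax⟩ := WellFounded.has_min
    (wellFounded_gt (α := Submodule ℝ V))
    {M | M ≤ Ω.orthogonal M ∧ M ⊓ L₁ = ⊥ ∧ M ⊓ L₂ = ⊥} ⟨⊥, by simp⟩
  refine ⟨M, ?_, hM₁, hM₂⟩
  by_contra hne
  have hlt : M < Ω.orthogonal M := lt_of_le_of_ne hM (Ne.symm hne)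
  obtain ⟨⟨x, hx⟩, hx₁, hx₂⟩ := exists_notMem_of_ne_top
    (A := (L₁ ⊔ M).comap (Ω.orthogonal M).subtype) (B := (L₂ ⊔ M).comap (Ω.orthogonal M).subtype)
    (by rw [Ne, Submodule.comap_subtype_eq_top]; exact not_orthogonal_le_sup halt hnd h₁ hlt hM₁)
    (by rw [Ne, Submodule.comap_subtype_eq_top]; exact not_orthogonal_le_sup halt hnd h₂ hlt hM₂)
  refine hmax (M ⊔ Submodule.span ℝ {x})
    ⟨?_, sup_span_inf_eq_bot hM₁ hx₁, sup_span_inf_eq_bot hM₂ hx₂⟩ ?_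
  · intro v hv w hw
    obtain ⟨m, hm, y, hy, rfl⟩ := Submodule.mem_sup.mp hv
    obtain ⟨c, rfl⟩ := Submodule.mem_span_singleton.mp hy
    obtain ⟨m', hm', y', hy', rfl⟩ := Submodule.mem_sup.mp hw
    obtain ⟨c', rfl⟩ := Submodule.mem_span_singleton.mp hy'
    have e1 : Ω m' m = 0 := hM hm m' hm'
    have e2 : Ω m' x = 0 := hx m' hm'
    have e3 : Ω x m = 0 := by rw [← halt.neg, show Ω m x = 0 from hx m hm, neg_zero]
    have e4 : Ω x x = 0 := halt x
    simp [e1, e2, e3, e4]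
  · refine lt_of_le_of_ne le_sup_left fun h => hx₁ ?_
    have : x ∈ M := by
      rw [h]
      exact Submodule.mem_sup_right (Submodule.mem_span_singleton_self x)
    exact Submodule.mem_sup_right this

end Transversality

section TripleSignature

variable {X V : Type*} [AddCommGroup X] [Module ℝ X] [FiniteDimensional ℝ X]
  [NormedAddCommGroup V] [NormedSpace ℝ V] [FiniteDimensional ℝ V]
  {Ω : BilinForm ℝ V} {Δ M : Submodule ℝ V}

/-- The signature of the triple `(Δ, range G, M)` is the signature of the index form. -/
theorem tripleSig_eq_formSignature (halt : LinearMap.IsAlt Ω) (hc : IsCompl Δ M)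
    (hΔ : IsIsotropic Ω Δ) (hM : IsIsotropic Ω M) {G : X →ₗ[ℝ] V} (hG : Function.Injective G) :
    tripleSig Ω Δ (LinearMap.range G) M = formSignature (indexForm Ω hc G).toQuadraticMap := by
  let π : V →ₗ[ℝ] Δ := Δ.projectionOnto M hc
  let π' : V →ₗ[ℝ] M := M.projectionOnto Δ hc.symm
  let pairing : BilinForm ℝ (Δ × M) :=
    Ω.comp (M.subtype ∘ₗ LinearMap.snd ℝ Δ M) (Δ.subtype ∘ₗ LinearMap.fst ℝ Δ M)
  let g := LinearEquiv.ofInjective G hG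
  let e : (X × (Δ × M)) ≃ₗ[ℝ] Δ × LinearMap.range G × M :=
    { toFun := fun z => (z.2.1 + π (G z.1), g z.1, z.2.2 + π' (G z.1))
      map_add' := fun z z' => by
        simp only [Prod.fst_add, Prod.snd_add, map_add, Prod.mk_add_mk]
        rw [add_add_add_comm, add_add_add_comm z.2.2]
      map_smul' := fun c z => by simp
      invFun := fun z => (g.symm z.2.1, z.1 - π z.2.1, z.2.2 - π' z.2.1)
      left_inv := fun z => by simp [g]
      right_inv := fun z => by
        have : G (g.symm z.2.1) = z.2.1 := congrArg Subtype.val (g.apply_symm_apply z.2.1)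
        simp [this] }
  have key : ∀ a m u w : V, Ω u a = 0 → Ω m w = 0 →
      Ω (u + a) (a + m) + Ω (a + m) (w + m) + Ω (w + m) (u + a) = Ω a (a + m) + Ω w u := by
    intro a m u w hua hmw
    have a3 : Ω a a = 0 := halt _
    have a4 : Ω m m = 0 := halt _
    have a5 := halt.neg a m
    have a6 := halt.neg a w
    have a7 := halt.neg u m
    simp only [map_add, LinearMap.add_apply]
    linarith
  have he : ∀ z, tripleQ Ω Δ (LinearMap.range G) M (e z) =
      ((indexForm Ω hc G).toQuadraticMap.prod pairing.toQuadraticMap) z := by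
    rintro ⟨x, u, w⟩
    have h := key (π (G x)) (π' (G x)) u w (hΔ u u.2 _ (π (G x)).2) (hM _ (π' (G x)).2 w w.2)
    rw [show (π (G x) : V) + π' (G x) = G x from
      Submodule.projection_add_projection_eq_self hc (G x)] at h
    exact h
  have hpair : formSignature pairing.toQuadraticMap = 0 := by
    refine formSignature_eq_zero_of_neg
      ((LinearEquiv.neg ℝ).prodCongr (LinearEquiv.refl ℝ M)) fun z => ?_
    simp [pairing]
  rw [tripleSig, ← posIndex_congr e fun z => (he z).symm.symm,
    ← posIndex_congr e (f := fun z => -((indexForm Ω hc G).toQuadraticMap.prod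
      pairing.toQuadraticMap) z) fun z => congrArg Neg.neg (he z),
    posIndex_sub_posIndex_neg, formSignature_prod, hpair, add_zero]

end TripleSignature

section Continuity

open Filter Topology

theorem Filter.Tendsto.tendsto_clm_apply {P X V : Type*} [NormedAddCommGroup X] [NormedSpace ℝ X]
    [NormedAddCommGroup V] [NormedSpace ℝ V] {l : Filter P} {A : P → X →L[ℝ] V}
    {A₀ : X →L[ℝ] V} {x : P → X} {x₀ : X} (hA : Tendsto A l (𝓝 A₀)) (hx : Tendsto x l (𝓝 x₀)) :
    Tendsto (fun p => A p (x p)) l (𝓝 (A₀ x₀)) :=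
  (isBoundedBilinearMap_apply.continuous.tendsto (A₀, x₀)).comp (hA.prodMk_nhds hx)

theorem Filter.Tendsto.const_clm_comp {P X V W : Type*} [NormedAddCommGroup X] [NormedSpace ℝ X]
    [NormedAddCommGroup V] [NormedSpace ℝ V] [NormedAddCommGroup W] [NormedSpace ℝ W]
    {l : Filter P} {A : P → X →L[ℝ] V} {A₀ : X →L[ℝ] V} (hA : Tendsto A l (𝓝 A₀))
    (R : V →L[ℝ] W) : Tendsto (fun p => R.comp (A p)) l (𝓝 (R.comp A₀)) :=
  ((continuous_const.clm_comp continuous_id).tendsto A₀).comp hA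

variable {P X V : Type*} [NormedAddCommGroup X] [NormedSpace ℝ X] [FiniteDimensional ℝ X]
  [NormedAddCommGroup V] [NormedSpace ℝ V] [FiniteDimensional ℝ V]
  {Ω : BilinForm ℝ V} {Δ M M' : Submodule ℝ V}

omit [FiniteDimensional ℝ X] [FiniteDimensional ℝ V] in
theorem injective_projection_comp_iff (hc : IsCompl Δ M) {G : X →L[ℝ] V}
    (hG : Function.Injective G) :
    Function.Injective (fun x => Δ.projection M hc (G x)) ↔
      M ⊓ LinearMap.range (G : X →ₗ[ℝ] V) = ⊥ := by
  have h0 := injective_iff_map_eq_zero (Δ.projection M hc ∘ₗ (G : X →ₗ[ℝ] V))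
  refine h0.trans ⟨fun h => ?_, fun h x hx => ?_⟩
  · rw [Submodule.eq_bot_iff]
    rintro _ ⟨hv, x, rfl⟩
    rw [h x ((Submodule.projection_apply_eq_zero_iff hc).mpr hv), map_zero]
  · have hx' : G x ∈ M ⊓ LinearMap.range (G : X →ₗ[ℝ] V) :=
      ⟨(Submodule.projection_apply_eq_zero_iff hc).mp hx, x, rfl⟩
    rw [h, Submodule.mem_bot] at hx'
    exact hG (hx'.trans (map_zero G).symm)

/-- The projection onto `Δ` along `M`, as a continuous linear map. -/
noncomputable def projCLM (hc : IsCompl Δ M) : V →L[ℝ] V :=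
  LinearMap.toContinuousLinearMap (Δ.projection M hc)

/-- Transversality to a fixed subspace is an open condition. -/
theorem eventually_inf_range_eq_bot {l : Filter P} {G : P → X →L[ℝ] V} {G₀ : X →L[ℝ] V}
    (hlim : Tendsto G l (𝓝 G₀)) (hinj : ∀ p, Function.Injective (G p))
    (hinj₀ : Function.Injective G₀) (hM : M ⊓ LinearMap.range (G₀ : X →ₗ[ℝ] V) = ⊥) :
    ∀ᶠ p in l, M ⊓ LinearMap.range (G p : X →ₗ[ℝ] V) = ⊥ := by
  obtain ⟨N, hN⟩ := M.exists_isCompl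
  have hc := hN.symm
  have h1 : Tendsto (fun p => (projCLM hc).comp (G p)) l (𝓝 ((projCLM hc).comp G₀)) :=
    hlim.const_clm_comp _
  have h2 := h1.eventually (ContinuousLinearMap.isOpen_injective.mem_nhds
    ((injective_projection_comp_iff hc hinj₀).mpr hM))
  filter_upwards [h2] with p hp
  exact (injective_projection_comp_iff hc (hinj p)).mp hp

/-- Given a left inverse `R` of `π ∘ G₀`, the solution `x` of `π (G x) = D v`. -/
noncomputable def solutionMap (R : V →L[ℝ] X) (π D : V →L[ℝ] V) (G : X →L[ℝ] V) : V →L[ℝ] X :=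
  (Ring.inverse (R.comp (π.comp G))).comp (R.comp D)

omit [FiniteDimensional ℝ V] in
theorem tendsto_solutionMap {R : V →L[ℝ] X} {π : V →L[ℝ] V} (D : V →L[ℝ] V) {G₀ : X →L[ℝ] V}
    (hR : R.comp (π.comp G₀) = 1) {l : Filter P} {G : P → X →L[ℝ] V}
    (hlim : Tendsto G l (𝓝 G₀)) (v : V) :
    Tendsto (fun p => solutionMap R π D (G p) v) l (𝓝 (solutionMap R π D G₀ v)) := by
  have : CompleteSpace X := FiniteDimensional.complete ℝ X
  have h1 : Tendsto (fun p => R.comp (π.comp (G p))) l (𝓝 (R.comp (π.comp G₀))) :=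
    (hlim.const_clm_comp _).const_clm_comp _
  have h2 : ContinuousAt Ring.inverse (R.comp (π.comp G₀)) := by
    rw [hR]
    exact NormedRing.inverse_continuousAt (1 : (X →L[ℝ] X)ˣ)
  have h3 := h2.tendsto.comp h1
  exact h3.tendsto_clm_apply tendsto_const_nhds

omit [FiniteDimensional ℝ X] in
theorem projection_solutionMap (hc : IsCompl Δ M) {R : V →L[ℝ] X} {D : V →L[ℝ] V}
    (hD : ∀ v, D v ∈ Δ) {G : X →L[ℝ] V} (hu : IsUnit (R.comp ((projCLM hc).comp G)))
    (hdim : Module.finrank ℝ X = Module.finrank ℝ Δ) (v : V) :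
    Δ.projection M hc (G (solutionMap R (projCLM hc) D G v)) = D v := by
  set S : X →L[ℝ] V := (projCLM hc).comp G with hS
  have hinv : ∀ x, Ring.inverse (R.comp S) (R (S x)) = x := fun x =>
    congrArg (fun f : X →L[ℝ] X => f x) (Ring.inverse_mul_cancel _ hu)
  have hinj : Function.Injective (S : X →ₗ[ℝ] V) := fun x y hxy => by
    rw [← hinv x, ← hinv y]
    exact congrArg (fun z => Ring.inverse (R.comp S) (R z)) hxy
  have hle : LinearMap.range (S : X →ₗ[ℝ] V) ≤ Δ := by
    rintro _ ⟨x, rfl⟩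
    exact Δ.projection_apply_mem hc _
  have heq := Submodule.eq_of_le_of_finrank_eq hle
    ((LinearMap.finrank_range_of_inj hinj).trans hdim)
  have hv : D v ∈ LinearMap.range (S : X →ₗ[ℝ] V) := heq ▸ hD v
  obtain ⟨x, hx⟩ := hv
  have hx' : S x = D v := hx
  change S (Ring.inverse (R.comp S) (R (D v))) = D v
  rw [← hx', hinv]

omit [FiniteDimensional ℝ X] in
theorem finrank_eq_of_isLagrangian_range (hnd : Ω.Nondegenerate) (hΔ : IsLagrangian Ω Δ)
    {G : X →L[ℝ] V} (hinj : Function.Injective G)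
    (hlag : IsLagrangian Ω (LinearMap.range (G : X →ₗ[ℝ] V))) :
    Module.finrank ℝ X = Module.finrank ℝ Δ := by
  have h1 := LinearMap.finrank_range_of_inj (f := (G : X →ₗ[ℝ] V)) hinj
  have h2 := hlag.two_mul_finrank hnd
  have h3 := hΔ.two_mul_finrank hnd
  omega

section

variable (halt : LinearMap.IsAlt Ω) (hnd : Ω.Nondegenerate) (hΔ : IsLagrangian Ω Δ)
  (hM : IsLagrangian Ω M) (hM' : IsLagrangian Ω M') (hMΔ : M ⊓ Δ = ⊥) (hM'Δ : M' ⊓ Δ = ⊥)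
  {l : Filter P} {G : P → X →L[ℝ] V} {G₀ : X →L[ℝ] V}
  (hlim : Tendsto G l (𝓝 G₀)) (hinj : ∀ p, Function.Injective (G p))
  (hinj₀ : Function.Injective G₀)
  (hlag : ∀ p, IsLagrangian Ω (LinearMap.range (G p : X →ₗ[ℝ] V)))
  (hlag₀ : IsLagrangian Ω (LinearMap.range (G₀ : X →ₗ[ℝ] V)))
  (hMG₀ : M ⊓ LinearMap.range (G₀ : X →ₗ[ℝ] V) = ⊥)
  (hM'G₀ : M' ⊓ LinearMap.range (G₀ : X →ₗ[ℝ] V) = ⊥)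

include halt hnd hΔ hM hM' hMΔ hM'Δ hlim hinj hinj₀ hlag hlag₀ hMG₀ hM'G₀ in
/-- The difference of the signatures of `(Δ, L, M')` and `(Δ, L, M)` is locally constant in `L`,
as long as `L` stays transverse to `M` and `M'`. -/
theorem eventually_tripleSig_sub_eq :
    ∀ᶠ p in l, tripleSig Ω Δ (LinearMap.range (G p : X →ₗ[ℝ] V)) M' -
        tripleSig Ω Δ (LinearMap.range (G p : X →ₗ[ℝ] V)) M =
      tripleSig Ω Δ (LinearMap.range (G₀ : X →ₗ[ℝ] V)) M' -
        tripleSig Ω Δ (LinearMap.range (G₀ : X →ₗ[ℝ] V)) M := by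
  have : CompleteSpace X := FiniteDimensional.complete ℝ X
  have hc := hΔ.isCompl hnd hM hMΔ
  have hc' := hΔ.isCompl hnd hM' hM'Δ
  have hdim := finrank_eq_of_isLagrangian_range hnd hΔ hinj₀ hlag₀
  let D : V →L[ℝ] V := LinearMap.toContinuousLinearMap (projDiff hc hc')
  obtain ⟨R', hR'⟩ := LinearMap.exists_leftInverse_of_injective
    (((projCLM hc).comp G₀ : X →L[ℝ] V) : X →ₗ[ℝ] V)
    (LinearMap.ker_eq_bot.mpr ((injective_projection_comp_iff hc hinj₀).mpr hMG₀))
  let R : V →L[ℝ] X := LinearMap.toContinuousLinearMap R'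
  have hR : R.comp ((projCLM hc).comp G₀) = 1 := by
    ext x
    exact congrArg (fun f : X →ₗ[ℝ] X => f x) hR'
  have hY : ∀ G' : X →L[ℝ] V, IsUnit (R.comp ((projCLM hc).comp G')) → ∀ v,
      Δ.projection M hc ((G' : X →ₗ[ℝ] V) ((solutionMap R (projCLM hc) D G' : V →ₗ[ℝ] X) v)) =
        projDiff hc hc' v :=
    fun G' hu v => projection_solutionMap hc (D := D) (projDiff_mem hc hc') hu hdim v
  have hu₀ : IsUnit (R.comp ((projCLM hc).comp G₀)) := hR ▸ isUnit_one
  have h1 : Tendsto (fun p => R.comp ((projCLM hc).comp (G p))) l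
      (𝓝 (R.comp ((projCLM hc).comp G₀))) :=
    (hlim.const_clm_comp _).const_clm_comp _
  have hu : ∀ᶠ p in l, IsUnit (R.comp ((projCLM hc).comp (G p))) :=
    h1.eventually (Units.isOpen.mem_nhds hu₀)
  have hsub : ∀ G' : X →L[ℝ] V, Function.Injective G' →
      IsLagrangian Ω (LinearMap.range (G' : X →ₗ[ℝ] V)) →
      IsUnit (R.comp ((projCLM hc).comp G')) →
      tripleSig Ω Δ (LinearMap.range (G' : X →ₗ[ℝ] V)) M' -
        tripleSig Ω Δ (LinearMap.range (G' : X →ₗ[ℝ] V)) M =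
      formSignature (Ω.comp (projDiff hc hc') LinearMap.id).toQuadraticMap -
        formSignature (correctionForm Ω hc hc' (G' : X →ₗ[ℝ] V)
          (solutionMap R (projCLM hc) D G' : V →ₗ[ℝ] X)).toQuadraticMap := by
    intro G' hi hl hu'
    rw [tripleSig_eq_formSignature halt hc hΔ.isIsotropic hM.isIsotropic hi,
      tripleSig_eq_formSignature halt hc' hΔ.isIsotropic hM'.isIsotropic hi]
    exact formSignature_indexForm_sub halt hc hc' hΔ.isIsotropic hM.isIsotropic hM'.isIsotropic
      hl.isIsotropic (hY G' hu')
  have hsg := eventually_formSignature_eq (l := l)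
    (B := fun p => correctionForm Ω hc hc' (G p : X →ₗ[ℝ] V)
      (solutionMap R (projCLM hc) D (G p) : V →ₗ[ℝ] X))
    (B₀ := correctionForm Ω hc hc' (G₀ : X →ₗ[ℝ] V)
      (solutionMap R (projCLM hc) D G₀ : V →ₗ[ℝ] X))
    (fun v w => by
      have h2 := (hlim.tendsto_clm_apply (tendsto_solutionMap D hR hlim w)).add_const w
      exact ((Ω (projDiff hc hc' v)).continuous_of_finiteDimensional.tendsto _).comp h2)
    (correctionForm_symm halt hc hc' hΔ.isIsotropic hM.isIsotropic hM'.isIsotropic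
      hlag₀.isIsotropic (hY G₀ hu₀))
    (hu.mono fun p hp => correctionForm_symm halt hc hc' hΔ.isIsotropic hM.isIsotropic
      hM'.isIsotropic (hlag p).isIsotropic (hY _ hp))
    (by
      filter_upwards [hu, eventually_inf_range_eq_bot hlim hinj hinj₀ hM'G₀] with p hp hp'
      rw [ker_correctionForm hc hc' (hY _ hp) hnd hp',
        ker_correctionForm hc hc' (hY _ hu₀) hnd hM'G₀])
  filter_upwards [hu, hsg] with p hp hp'
  rw [hsub _ (hinj p) (hlag p) hp, hsub _ hinj₀ hlag₀ hu₀, hp']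

include halt hnd hΔ hM hMΔ hlim hinj hinj₀ hlag hlag₀ hMG₀ in
/-- The signature of `(Δ, L, M)` is locally constant in `L` as long as `dim (Δ ∩ L)` is. -/
theorem eventually_tripleSig_eq
    (hdim : ∀ p, Module.finrank ℝ (Δ.comap (G p : X →ₗ[ℝ] V)) =
      Module.finrank ℝ (Δ.comap (G₀ : X →ₗ[ℝ] V))) :
    ∀ᶠ p in l, tripleSig Ω Δ (LinearMap.range (G p : X →ₗ[ℝ] V)) M =
      tripleSig Ω Δ (LinearMap.range (G₀ : X →ₗ[ℝ] V)) M := by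
  have hc := hΔ.isCompl hnd hM hMΔ
  have hker : ∀ G' : X →L[ℝ] V, IsLagrangian Ω (LinearMap.range (G' : X →ₗ[ℝ] V)) →
      M ⊓ LinearMap.range (G' : X →ₗ[ℝ] V) = ⊥ →
      LinearMap.ker (indexForm Ω hc (G' : X →ₗ[ℝ] V)) = Δ.comap (G' : X →ₗ[ℝ] V) :=
    fun G' hl h => ker_indexForm hc hl.isIsotropic
      (fun v hv => hl.mem_of_forall halt (by rintro _ ⟨y, rfl⟩; exact hv y)) h
  have hsg := eventually_formSignature_eq (l := l)
    (B := fun p => indexForm Ω hc (G p : X →ₗ[ℝ] V)) (B₀ := indexForm Ω hc (G₀ : X →ₗ[ℝ] V))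
    (fun x y => by
      have hx : Tendsto (fun p => G p x) l (𝓝 (G₀ x)) := hlim.tendsto_clm_apply tendsto_const_nhds
      have hy : Tendsto (fun p => G p y) l (𝓝 (G₀ y)) := hlim.tendsto_clm_apply tendsto_const_nhds
      let Ω' : V →L[ℝ] V →L[ℝ] ℝ := LinearMap.toContinuousLinearMap
        ((LinearMap.toContinuousLinearMap : (V →ₗ[ℝ] ℝ) ≃ₗ[ℝ] V →L[ℝ] ℝ) ∘ₗ Ω)
      have h2 : Tendsto (fun p => Ω' (projCLM hc (G p x))) l (𝓝 (Ω' (projCLM hc (G₀ x)))) :=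
        ((Ω'.continuous.comp (projCLM hc).continuous).tendsto _).comp hx
      exact h2.tendsto_clm_apply hy)
    (indexForm_symm halt hc hΔ.isIsotropic hM.isIsotropic hlag₀.isIsotropic)
    (Eventually.of_forall fun p =>
      indexForm_symm halt hc hΔ.isIsotropic hM.isIsotropic (hlag p).isIsotropic)
    (by
      filter_upwards [eventually_inf_range_eq_bot hlim hinj hinj₀ hMG₀] with p hp
      rw [hker _ (hlag p) hp, hker _ hlag₀ hMG₀, hdim])
  filter_upwards [hsg] with p hp
  rw [tripleSig_eq_formSignature halt hc hΔ.isIsotropic hM.isIsotropic (hinj p),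
    tripleSig_eq_formSignature halt hc hΔ.isIsotropic hM.isIsotropic hinj₀, hp]

end

end Continuity

section Subdivision

open Filter Topology unitInterval

variable {𝓜 : Type*}

/-- A partition `t` of the unit interval into `k` pieces, with a label admissible on each piece. -/
def IsAdmissible (T : I → Set 𝓜) (k : ℕ) (t : ℕ → I) (M : ℕ → 𝓜) : Prop :=
  t 0 = 0 ∧ t k = 1 ∧ ∀ ν < k, t ν ≤ t (ν + 1) ∧ ∀ x ∈ Set.Icc (t ν) (t (ν + 1)), M ν ∈ T x

/-- The sum of the increments of `f` along the pieces of a labelled partition. -/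
def incrementSum (f : I → 𝓜 → ℤ) (k : ℕ) (t : ℕ → I) (M : ℕ → 𝓜) : ℤ :=
  ∑ ν ∈ Finset.range k, (f (t ν) (M ν) - f (t (ν + 1)) (M ν))

section OneParameter

variable {T : I → Set 𝓜} {f : I → 𝓜 → ℤ} {k k' : ℕ} {t t' : ℕ → I} {M M' : ℕ → 𝓜}

theorem eventually_incrementSum_min_add
    (hdiff : ∀ x₀, ∀ M ∈ T x₀, ∀ M' ∈ T x₀,
      ∀ᶠ x in 𝓝 x₀, f x M - f x M' = f x₀ M - f x₀ M')
    (h : IsAdmissible T k t M) {x₀ : I} {N : 𝓜} (hN : N ∈ T x₀) :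
    ∀ᶠ x in 𝓝 x₀, incrementSum f k (fun ν => min x (t ν)) M + f x N =
      incrementSum f k (fun ν => min x₀ (t ν)) M + f x₀ N := by
  obtain ⟨h0, hk, hstep⟩ := h
  let u : ℕ → I → ℤ := fun ν x => f x (M ν) - f x N
  let d : ℕ → I → ℤ := fun ν x => u ν (min x (t ν)) - u ν (min x (t (ν + 1)))
  have hsum : ∀ x, incrementSum f k (fun ν => min x (t ν)) M + f x N =
      ∑ ν ∈ Finset.range k, d ν x + f 0 N := by
    intro x
    have h1 := Finset.sum_range_sub' (fun ν => f (min x (t ν)) N) k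
    rw [h0, hk, min_eq_right unitInterval.nonneg', min_eq_left unitInterval.le_one'] at h1
    have h2 : incrementSum f k (fun ν => min x (t ν)) M = ∑ ν ∈ Finset.range k, d ν x +
        ∑ ν ∈ Finset.range k, (f (min x (t ν)) N - f (min x (t (ν + 1))) N) := by
      rw [← Finset.sum_add_distrib]
      refine Finset.sum_congr rfl fun ν _ => ?_
      simp only [d, u]
      ring
    rw [h2, h1]
    ring
  have hd : ∀ ν ∈ Finset.range k, ∀ᶠ x in 𝓝 x₀, d ν x = d ν x₀ := by
    intro ν hν
    obtain ⟨hle, hT⟩ := hstep ν (Finset.mem_range.mp hν)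
    rcases lt_or_ge x₀ (t ν) with hlt | hge
    · have hzero : ∀ x < t ν, d ν x = 0 := fun x hx => by
        simp only [d]
        rw [min_eq_left hx.le, min_eq_left (hx.le.trans hle), sub_self]
      filter_upwards [Iio_mem_nhds hlt] with x hx
      rw [hzero x hx, hzero x₀ hlt]
    · have hright : ∀ x, t (ν + 1) < x → d ν x = u ν (t ν) - u ν (t (ν + 1)) := fun x hx => by
        simp only [d]
        rw [min_eq_right hx.le, min_eq_right (hle.trans hx.le)]
      rcases lt_or_ge (t (ν + 1)) x₀ with hlt | hle'
      · filter_upwards [Ioi_mem_nhds hlt] with x hx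
        rw [hright x hx, hright x₀ hlt]
      · have hu : ∀ᶠ x in 𝓝 x₀, u ν x = u ν x₀ := hdiff x₀ _ (hT x₀ ⟨hge, hle'⟩) _ hN
        have hmin : ∀ y : I, x₀ ≤ y → ∀ᶠ x in 𝓝 x₀, u ν (min x y) = u ν (min x₀ y) := by
          intro y hy
          have hc : Tendsto (fun x : I => min x y) (𝓝 x₀) (𝓝 x₀) := by
            conv_rhs => rw [← min_eq_left hy]
            exact (continuous_id.min continuous_const).tendsto x₀
          rw [min_eq_left hy]
          exact hc.eventually hu
        have hfst : ∀ᶠ x in 𝓝 x₀, u ν (min x (t ν)) = u ν (min x₀ (t ν)) := by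
          rcases hge.lt_or_eq with hlt | heq
          · filter_upwards [Ioi_mem_nhds hlt] with x hx
            rw [min_eq_right (le_of_lt hx), min_eq_right hge]
          · exact hmin _ heq.ge
        filter_upwards [hfst, hmin _ hle'] with x h1 h2
        simp only [d]
        rw [h1, h2]
  filter_upwards [(Finset.eventually_all _).mpr hd] with x hx
  rw [hsum, hsum, Finset.sum_congr rfl hx]

/-- The increment sum does not depend on the admissible labelled partition. -/
theorem incrementSum_eq_of_isAdmissible (hne : ∀ x, (T x).Nonempty)
    (hdiff : ∀ x₀, ∀ M ∈ T x₀, ∀ M' ∈ T x₀,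
      ∀ᶠ x in 𝓝 x₀, f x M - f x M' = f x₀ M - f x₀ M')
    (h : IsAdmissible T k t M) (h' : IsAdmissible T k' t' M') :
    incrementSum f k t M = incrementSum f k' t' M' := by
  let g : I → ℤ := fun x => incrementSum f k (fun ν => min x (t ν)) M -
    incrementSum f k' (fun ν => min x (t' ν)) M'
  have hg : IsLocallyConstant g := by
    rw [IsLocallyConstant.iff_eventually_eq]
    intro x₀
    obtain ⟨N, hN⟩ := hne x₀
    filter_upwards [eventually_incrementSum_min_add hdiff h hN,
      eventually_incrementSum_min_add hdiff h' hN] with x h1 h2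
    simp only [g]
    linarith
  have h01 := hg.apply_eq_of_isPreconnected isPreconnected_univ (Set.mem_univ (0 : I))
    (Set.mem_univ (1 : I))
  have h0 : ∀ t : ℕ → I, (fun ν => min 0 (t ν)) = fun _ => 0 := fun t =>
    funext fun ν => min_eq_left unitInterval.nonneg'
  have h1 : ∀ t : ℕ → I, (fun ν => min 1 (t ν)) = t := fun t =>
    funext fun ν => min_eq_right unitInterval.le_one'
  simp only [g, h0, h1] at h01
  simp only [incrementSum, sub_self, Finset.sum_const_zero] at h01 ⊢
  linarith

theorem exists_isAdmissible (hne : ∀ x, (T x).Nonempty) (hopen : ∀ M, IsOpen {x | M ∈ T x}) :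
    ∃ k t M, IsAdmissible T k t M := by
  obtain ⟨t, h0, hmono, ⟨k, hk⟩, ht⟩ := exists_monotone_Icc_subset_open_cover_unitInterval
    (c := fun M => {x | M ∈ T x}) hopen (fun x _ => Set.mem_iUnion.mpr (hne x))
  choose M hM using ht
  exact ⟨k, t, M, h0, hk k le_rfl, fun ν _ => ⟨hmono ν.le_succ, fun x hx => hM ν hx⟩⟩

end OneParameter

section TwoParameters

variable {T : I × I → Set 𝓜} {f : I × I → 𝓜 → ℤ} {k k' : ℕ} {t t' : ℕ → I} {M M' : ℕ → 𝓜}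

theorem eventually_isAdmissible (hopen : ∀ M, IsOpen {q | M ∈ T q}) {s₀ : I}
    (h : IsAdmissible (fun x => T (s₀, x)) k t M) :
    ∀ᶠ s in 𝓝 s₀, IsAdmissible (fun x => T (s, x)) k t M := by
  obtain ⟨h0, hk, hstep⟩ := h
  have hT : ∀ ν ∈ Finset.range k, ∀ᶠ s in 𝓝 s₀, ∀ x ∈ Set.Icc (t ν) (t (ν + 1)),
      M ν ∈ T (s, x) := fun ν hν =>
    isCompact_Icc.eventually_forall_of_forall_eventually fun x hx =>
      (hopen (M ν)).mem_nhds ((hstep ν (Finset.mem_range.mp hν)).2 x hx)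
  filter_upwards [(Finset.eventually_all _).mpr hT] with s hs
  exact ⟨h0, hk, fun ν hν => ⟨(hstep ν hν).1, hs ν (Finset.mem_range.mpr hν)⟩⟩

theorem eventually_incrementSum_eq (hne : ∀ q, (T q).Nonempty)
    (hdiff : ∀ q₀, ∀ M ∈ T q₀, ∀ M' ∈ T q₀,
      ∀ᶠ q in 𝓝 q₀, f q M - f q M' = f q₀ M - f q₀ M')
    (hleft : ∀ s₀, ∀ M ∈ T (s₀, 0), ∀ᶠ s in 𝓝 s₀, f (s, 0) M = f (s₀, 0) M)
    (hright : ∀ s₀, ∀ M ∈ T (s₀, 1), ∀ᶠ s in 𝓝 s₀, f (s, 1) M = f (s₀, 1) M)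
    {s₀ : I} (h : IsAdmissible (fun x => T (s₀, x)) k t M) :
    ∀ᶠ s in 𝓝 s₀, incrementSum (fun x => f (s, x)) k t M =
      incrementSum (fun x => f (s₀, x)) k t M := by
  obtain ⟨h0, hk, hstep⟩ := h
  choose N hN using fun ν => hne (s₀, t ν)
  have hcomp : ∀ x, ∀ A ∈ T (s₀, x), ∀ B ∈ T (s₀, x), ∀ᶠ s in 𝓝 s₀,
      f (s, x) A - f (s, x) B = f (s₀, x) A - f (s₀, x) B := fun x A hA B hB =>
    (Continuous.prodMk_left x).tendsto s₀ |>.eventually (hdiff (s₀, x) A hA B hB)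
  let d : ℕ → I → ℤ := fun ν s => (f (s, t ν) (M ν) - f (s, t ν) (N ν)) -
    (f (s, t (ν + 1)) (M ν) - f (s, t (ν + 1)) (N (ν + 1)))
  have hd : ∀ ν ∈ Finset.range k, ∀ᶠ s in 𝓝 s₀, d ν s = d ν s₀ := by
    intro ν hν
    obtain ⟨hle, hT⟩ := hstep ν (Finset.mem_range.mp hν)
    filter_upwards [hcomp _ _ (hT _ ⟨le_rfl, hle⟩) _ (hN ν),
      hcomp _ _ (hT _ ⟨hle, le_rfl⟩) _ (hN (ν + 1))] with s h1 h2
    simp only [d, h1, h2]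
  have hsum : ∀ s, incrementSum (fun x => f (s, x)) k t M =
      ∑ ν ∈ Finset.range k, d ν s + (f (s, 0) (N 0) - f (s, 1) (N k)) := by
    intro s
    have h1 := Finset.sum_range_sub' (fun ν => f (s, t ν) (N ν)) k
    rw [h0, hk] at h1
    rw [← h1, ← Finset.sum_add_distrib]
    refine Finset.sum_congr rfl fun ν _ => ?_
    simp only [d]
    ring
  have hN0 := hN 0
  have hNk := hN k
  rw [h0] at hN0
  rw [hk] at hNk
  filter_upwards [(Finset.eventually_all _).mpr hd, hleft s₀ _ hN0, hright s₀ _ hNk]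
    with s h1 h2 h3
  rw [hsum, hsum, Finset.sum_congr rfl h1, h2, h3]

/-- Homotopy invariance of the increment sum. -/
theorem incrementSum_zero_eq_one (hne : ∀ q, (T q).Nonempty)
    (hopen : ∀ M, IsOpen {q | M ∈ T q})
    (hdiff : ∀ q₀, ∀ M ∈ T q₀, ∀ M' ∈ T q₀,
      ∀ᶠ q in 𝓝 q₀, f q M - f q M' = f q₀ M - f q₀ M')
    (hleft : ∀ s₀, ∀ M ∈ T (s₀, 0), ∀ᶠ s in 𝓝 s₀, f (s, 0) M = f (s₀, 0) M)
    (hright : ∀ s₀, ∀ M ∈ T (s₀, 1), ∀ᶠ s in 𝓝 s₀, f (s, 1) M = f (s₀, 1) M)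
    (h : IsAdmissible (fun x => T (0, x)) k t M) (h' : IsAdmissible (fun x => T (1, x)) k' t' M') :
    incrementSum (fun x => f (0, x)) k t M = incrementSum (fun x => f (1, x)) k' t' M' := by
  choose K τ L hL using fun s : I => exists_isAdmissible (T := fun x => T (s, x))
    (fun x => hne (s, x)) (fun M => (hopen M).preimage (Continuous.prodMk_right s))
  have hwd : ∀ (s : I) {k k' : ℕ} {t t' : ℕ → I} {M M' : ℕ → 𝓜},
      IsAdmissible (fun x => T (s, x)) k t M → IsAdmissible (fun x => T (s, x)) k' t' M' →
      incrementSum (fun x => f (s, x)) k t M = incrementSum (fun x => f (s, x)) k' t' M' :=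
    fun s _ _ _ _ _ _ h h' => incrementSum_eq_of_isAdmissible (fun x => hne (s, x))
      (fun x A hA B hB => (Continuous.prodMk_right s).tendsto x |>.eventually
        (hdiff (s, x) A hA B hB)) h h'
  have hg : IsLocallyConstant fun s => incrementSum (fun x => f (s, x)) (K s) (τ s) (L s) := by
    rw [IsLocallyConstant.iff_eventually_eq]
    intro s₀
    filter_upwards [eventually_isAdmissible hopen (hL s₀),
      eventually_incrementSum_eq hne hdiff hleft hright (hL s₀)] with s h1 h2
    rw [hwd s (hL s) h1, h2]
  rw [hwd 0 h (hL 0), hwd 1 h' (hL 1)]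
  exact hg.apply_eq_of_isPreconnected isPreconnected_univ (Set.mem_univ (0 : I))
    (Set.mem_univ (1 : I))

end TwoParameters

end Subdivision

section AdmissibleData

open unitInterval

variable {ω : BilinForm ℝ E} {L₁ L₂ : ℝ → Submodule ℝ E}

theorem AdmissibleData.mem_Icc (D : AdmissibleData ω 0 1 L₁ L₂) {ν : ℕ} (hν : ν ≤ D.k) :
    D.t ν ∈ I := by
  have hmono : ∀ i j, i ≤ j → j ≤ D.k → D.t i ≤ D.t j := by
    intro i j hij
    induction j, hij using Nat.le_induction with
    | base => exact fun _ => le_rfl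
    | succ j _ ih => exact fun hj => (ih (by omega)).trans (D.hmono j (by omega))
  refine ⟨?_, ?_⟩
  · simpa [D.ht0] using hmono 0 ν (Nat.zero_le _) hν
  · simpa [D.htk] using hmono ν D.k hν le_rfl

/-- The subspaces usable as labels at the parameter `x`. -/
def commonComplements (ω : BilinForm ℝ E) (L₁ L₂ : ℝ → Submodule ℝ E) (x : I) :
    Set (Submodule ℝ E) :=
  {M | IsLagrangian ω M ∧ M ⊓ L₁ x = ⊥ ∧ M ⊓ L₂ x = ⊥}

theorem AdmissibleData.exists_isAdmissible (D : AdmissibleData ω 0 1 L₁ L₂) :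
    ∃ t M, IsAdmissible (commonComplements ω L₁ L₂) D.k t M ∧
      dataSum D = 1 / 2 * (incrementSum (fun x M => tripleSig ω (L₁ x) (L₂ x) M) D.k t M : ℝ) := by
  have hval : ∀ ν ≤ D.k, (Set.projIcc (0 : ℝ) 1 zero_le_one (D.t ν) : ℝ) = D.t ν := fun ν hν =>
    congrArg Subtype.val (Set.projIcc_of_mem zero_le_one (D.mem_Icc hν))
  refine ⟨fun ν => Set.projIcc 0 1 zero_le_one (D.t ν), fun ν => D.M (ν + 1), ⟨?_, ?_, ?_⟩, ?_⟩
  · simp only [D.ht0]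
    exact Set.projIcc_left _
  · simp only [D.htk]
    exact Set.projIcc_right _
  · intro ν hν
    refine ⟨Set.monotone_projIcc _ (D.hmono ν hν), fun x hx => ?_⟩
    have hx' : (x : ℝ) ∈ Set.Icc (D.t ν) (D.t (ν + 1)) := by
      rw [← hval ν hν.le, ← hval (ν + 1) hν]
      exact hx
    exact ⟨D.hlag ν hν, D.htrans1 ν hν x hx', D.htrans2 ν hν x hx'⟩
  · rw [dataSum, incrementSum, Int.cast_sum]
    congr 1
    refine Finset.sum_congr rfl fun ν hν => ?_
    have hν' := Finset.mem_range.mp hν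
    rw [hval ν hν'.le, hval (ν + 1) hν', Int.cast_sub]

end AdmissibleData

section Graph

variable {ω : BilinForm ℝ E}

theorem prodNegForm_apply (x y : E × E) : prodNegForm ω x y = ω x.1 y.1 - ω x.2 y.2 :=
  rfl

theorem prodNegForm_isAlt (halt : LinearMap.IsAlt ω) : LinearMap.IsAlt (prodNegForm ω) :=
  fun x => by rw [prodNegForm_apply, halt, halt, sub_zero]

theorem prodNegForm_nondegenerate (hnd : ω.Nondegenerate) : (prodNegForm ω).Nondegenerate := by
  constructor
  · intro x hx
    ext
    · exact hnd.1 _ fun y => by simpa [prodNegForm_apply] using hx (y, 0)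
    · exact hnd.1 _ fun y => by simpa [prodNegForm_apply] using hx (0, y)
  · intro x hx
    ext
    · exact hnd.2 _ fun y => by simpa [prodNegForm_apply] using hx (y, 0)
    · exact hnd.2 _ fun y => by simpa [prodNegForm_apply] using hx (0, y)

theorem isLagrangian_graphSub (hnd : ω.Nondegenerate) {A : E →L[ℝ] E}
    (hA : Function.Surjective A) (hω : ∀ x y, ω (A x) (A y) = ω x y) :
    IsLagrangian (prodNegForm ω) (graphSub A) := by
  ext ⟨a, b⟩
  constructor
  · intro h
    obtain ⟨c, rfl⟩ := hA a
    have hcb : c - b = 0 := hnd.2 _ fun x => by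
      have h1 : prodNegForm ω (A x, x) (A c, b) = 0 := h (A x, x) ⟨x, rfl⟩
      rw [prodNegForm_apply, hω] at h1
      rw [map_sub]
      exact h1
    exact ⟨c, Prod.ext rfl (sub_eq_zero.mp hcb)⟩
  · rintro ⟨x, hx⟩ _ ⟨y, rfl⟩
    rw [← hx]
    change prodNegForm ω (A y, y) (A x, x) = 0
    rw [prodNegForm_apply, hω, sub_self]

/-- The parametrization `x ↦ (A x, x)` of the graph of `A`. -/
noncomputable def graphMap (A : E →L[ℝ] E) : E →L[ℝ] E × E :=
  A.prod (ContinuousLinearMap.id ℝ E)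

theorem graphMap_injective (A : E →L[ℝ] E) : Function.Injective (graphMap A) :=
  fun _ _ h => congrArg Prod.snd h

theorem comap_diagSub_graphMap (A : E →L[ℝ] E) :
    diagSub.comap (graphMap A : E →ₗ[ℝ] E × E) =
      LinearMap.ker ((A : E →ₗ[ℝ] E) - LinearMap.id) := by
  ext x
  rw [LinearMap.mem_ker, LinearMap.sub_apply, sub_eq_zero]
  constructor
  · rintro ⟨y, hy⟩
    exact (congrArg Prod.fst hy).symm.trans (congrArg Prod.snd hy)
  · intro h
    exact ⟨x, Prod.ext h.symm rfl⟩

theorem continuous_graphMap : Continuous (graphMap : (E →L[ℝ] E) → E →L[ℝ] E × E) :=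
  (ContinuousLinearMap.prodₗᵢ ℝ (E := E) (F := E) (G := E) (𝕜 := ℝ)).continuous.comp
    (continuous_id.prodMk continuous_const)

end Graph

/-- local constancy of the index `μ`: if `H : [0,1] × [0,1] → Sp(E)` is a
continuous family with `H(s,0) = I` for all `s` and `dim ker(H(s,1) − I)` independent of `s`,
then `μ(H(0,·)) = μ(H(1,·))`, where `μ(A) = [const_Δ : Γ_{A(t)}]` in `E × E⁻` is computed from
arbitrary admissible data. -/
theorem mu_locally_constant [FiniteDimensional ℝ E]
    (ω : BilinForm ℝ E) (halt : LinearMap.IsAlt ω)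
    (hnd : LinearMap.BilinForm.Nondegenerate ω)
    (H : ℝ → ℝ → E →L[ℝ] E)
    (hcont : ContinuousOn (fun p : ℝ × ℝ => H p.1 p.2) (Set.Icc 0 1 ×ˢ Set.Icc 0 1))
    (hbij : ∀ s ∈ Set.Icc (0:ℝ) 1, ∀ t ∈ Set.Icc (0:ℝ) 1, Function.Bijective (H s t))
    (hsymp : ∀ s ∈ Set.Icc (0:ℝ) 1, ∀ t ∈ Set.Icc (0:ℝ) 1,
      ∀ x y, ω (H s t x) (H s t y) = ω x y)
    (hid : ∀ s ∈ Set.Icc (0:ℝ) 1, H s 0 = ContinuousLinearMap.id ℝ E)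
    (hker : ∀ s ∈ Set.Icc (0:ℝ) 1, ∀ s' ∈ Set.Icc (0:ℝ) 1,
      Module.finrank ℝ ↥(LinearMap.ker ((H s 1 : E →ₗ[ℝ] E) - LinearMap.id)) =
        Module.finrank ℝ ↥(LinearMap.ker ((H s' 1 : E →ₗ[ℝ] E) - LinearMap.id)))
    (D0 : AdmissibleData (prodNegForm ω) 0 1 (fun _ => diagSub)
      (fun t => graphSub (H 0 t)))
    (D1 : AdmissibleData (prodNegForm ω) 0 1 (fun _ => diagSub)
      (fun t => graphSub (H 1 t))) :
    dataSum D0 = dataSum D1 := by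
  let A : unitInterval × unitInterval → E →L[ℝ] E := fun q => H q.1 q.2
  let Γ : unitInterval × unitInterval → E →L[ℝ] E × E := fun q => graphMap (A q)
  have hA : Continuous A := hcont.comp_continuous
    (continuous_subtype_val.prodMap continuous_subtype_val) fun q => ⟨q.1.2, q.2.2⟩
  have hΓ : Continuous Γ := continuous_graphMap.comp hA
  have hΩ := prodNegForm_isAlt halt
  have hΩnd := prodNegForm_nondegenerate hnd
  have hΔ : IsLagrangian (prodNegForm ω) diagSub :=
    isLagrangian_graphSub hnd (A := ContinuousLinearMap.id ℝ E) Function.surjective_id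
      fun _ _ => rfl
  have hlag : ∀ q, IsLagrangian (prodNegForm ω) (LinearMap.range (Γ q : E →ₗ[ℝ] E × E)) :=
    fun q => isLagrangian_graphSub hnd (hbij _ q.1.2 _ q.2.2).2 (hsymp _ q.1.2 _ q.2.2)
  have hinj : ∀ q, Function.Injective (Γ q) := fun q => graphMap_injective (A q)
  let T : unitInterval × unitInterval → Set (Submodule ℝ (E × E)) := fun q =>
    commonComplements (prodNegForm ω) (fun _ => diagSub) (fun t => graphSub (H q.1 t)) q.2
  let f : unitInterval × unitInterval → Submodule ℝ (E × E) → ℤ := fun q M =>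
    tripleSig (prodNegForm ω) diagSub (graphSub (H q.1 q.2)) M
  obtain ⟨t, M, hD, hsum⟩ := D0.exists_isAdmissible
  obtain ⟨t', M', hD', hsum'⟩ := D1.exists_isAdmissible
  have key : incrementSum (fun x => f (0, x)) D0.k t M =
      incrementSum (fun x => f (1, x)) D1.k t' M' := by
    refine incrementSum_zero_eq_one (T := T) (f := f) ?_ ?_ ?_ ?_ ?_ hD hD'
    · exact fun q => exists_isLagrangian_inf_eq_bot hΩ hΩnd hΔ (hlag q)
    · refine fun N => isOpen_iff_mem_nhds.mpr fun q₀ hN => ?_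
      filter_upwards [eventually_inf_range_eq_bot (hΓ.tendsto q₀) hinj (hinj q₀) hN.2.2] with q hq
      exact ⟨hN.1, hN.2.1, hq⟩
    · intro q₀ N hN N' hN'
      exact eventually_tripleSig_sub_eq (G := Γ) (G₀ := Γ q₀) hΩ hΩnd hΔ hN'.1 hN.1 hN'.2.1
        hN.2.1 (hΓ.tendsto q₀) hinj (hinj q₀) hlag (hlag q₀) hN'.2.2 hN.2.2
    · intro s₀ N _
      refine Filter.Eventually.of_forall fun s => ?_
      change tripleSig _ _ (graphSub (H s 0)) N = tripleSig _ _ (graphSub (H s₀ 0)) N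
      rw [hid s s.2, hid s₀ s₀.2]
    · intro s₀ N hN
      refine eventually_tripleSig_eq (G := fun s => Γ (s, 1)) (G₀ := Γ (s₀, 1)) hΩ hΩnd hΔ
        hN.1 hN.2.1 ((hΓ.comp (Continuous.prodMk_left 1)).tendsto s₀) (fun s => hinj (s, 1))
        (hinj (s₀, 1)) (fun s => hlag (s, 1)) (hlag (s₀, 1)) hN.2.2 fun s => ?_
      have h1 := hker s s.2 s₀ s₀.2
      rw [← comap_diagSub_graphMap, ← comap_diagSub_graphMap] at h1
      exact h1
  rw [hsum, hsum']
  exact congrArg (fun z : ℤ => (1 / 2 * z : ℝ)) key
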